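/- Let n > 2, 1 ≤ s < n-1, x ∈ ℝⁿ, β ∈ ℝˢ, and set α_i = e_i(β) for i = 1,…,s (so Condition C holds with roots -β_1,…,-β_s). Fix k with s+1 ≤ k ≤ n-1. If S_{k;s}(x)² = S_{k-1;s}(x) · S_{k+1;s}(x) and the two sides are not both zero, then some real value occurs at least n times in the multiset {x_1,…,x_n, -β_1,…,-β_s}. -/

import Mathlib

/-- The `k`-th elementary symmetric polynomial of a vector `v ∈ ℝ^m`. -/
noncomputable def esymmFin {m : ℕ} (v : Fin m → ℝ) (k : ℕ) : ℝ :=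
  ∑ t ∈ Finset.univ.powersetCard k, ∏ i ∈ t, v i

/-- `σ_k(v)` with integer index: equals `esymmFin v k` for `0 ≤ k` (hence `0` for `k > m`),
and `0` for `k < 0`. -/
noncomputable def sigmaZ {m : ℕ} (v : Fin m → ℝ) (k : ℤ) : ℝ :=
  if 0 ≤ k then esymmFin v k.toNat else 0

/-- The `k`-th elementary symmetric mean `E_k(v) = σ_k(v) / C(m,k)`, integer index. -/
noncomputable def emeanZ {m : ℕ} (v : Fin m → ℝ) (k : ℤ) : ℝ :=
  if 0 ≤ k then esymmFin v k.toNat / (m.choose k.toNat) else 0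

/-- `S_{k;s}(x) = E_k(x) + ∑_{i=1}^s α_i E_{k-i}(x)`. -/
noncomputable def Ssk {n s : ℕ} (x : Fin n → ℝ) (α : Fin s → ℝ) (k : ℤ) : ℝ :=
  emeanZ x k + ∑ i : Fin s, α i * emeanZ x (k - ((i : ℕ) + 1))

/-- `Q_{k;s}(x) = σ_k(x) + ∑_{i=1}^s α_i σ_{k-i}(x)`. -/
noncomputable def Qks {n s : ℕ} (x : Fin n → ℝ) (α : Fin s → ℝ) (k : ℤ) : ℝ :=
  sigmaZ x k + ∑ i : Fin s, α i * sigmaZ x (k - ((i : ℕ) + 1))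

/-- Condition C: `t^s + α_1 t^{s-1} + ⋯ + α_s` has only real roots `-β_1,…,-β_s`;
equivalently `α_i = e_i(β)` for some `β ∈ ℝ^s`. -/
def ConditionC {s : ℕ} (α : Fin s → ℝ) : Prop :=
  ∃ β : Fin s → ℝ, ∀ i : Fin s, α i = esymmFin β ((i : ℕ) + 1)

namespace Polynomial

/-- Rolle: the derivative of a real-rooted polynomial is real-rooted. -/
theorem Splits.derivative_real {p : ℝ[X]} (hp : p.Splits) : (derivative p).Splits := by
  rcases Nat.eq_zero_or_pos p.natDegree with h | h
  · rw [eq_C_of_natDegree_eq_zero h]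
    simp
  · rw [splits_iff_card_roots] at hp ⊢
    have h1 := card_roots_le_derivative p
    have h2 := card_roots' (derivative p)
    have h3 := natDegree_derivative_lt h.ne'
    omega

theorem Splits.reflect {p : ℝ[X]} (hp : p.Splits) {N : ℕ} (hN : p.natDegree ≤ N) :
    (p.reflect N).Splits := by
  by_cases h0 : p = 0
  · simp [h0]
  obtain ⟨m, hm⟩ := splits_iff_exists_multiset.mp hp
  have hc : m.card ≤ N := by
    rw [hm, natDegree_C_mul (leadingCoeff_ne_zero.mpr h0),
      natDegree_multiset_prod_X_sub_C_eq_card] at hN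
    exact hN
  rw [hm, reflect_C_mul]
  refine Splits.C_mul ?_ _
  clear hm hN hp h0
  induction m using Multiset.induction_on generalizing N with
  | empty => simp
  | cons r m ih =>
    obtain ⟨N, rfl⟩ : ∃ M, N = 1 + M := ⟨N - 1, by simp at hc; omega⟩
    have hcard : m.card ≤ N := by simp at hc; omega
    rw [Multiset.map_cons, Multiset.prod_cons, reflect_mul _ _ (by simp)
      (by rwa [natDegree_multiset_prod_X_sub_C_eq_card])]
    exact Splits.mul (Splits.of_natDegree_le_one (natDegree_reflect_le.trans (by simp))) (ih hcard)

/-- The Laguerre expression of a product of real linear factors is positive off its roots. -/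
theorem laguerre_multiset_prod_pos (m : Multiset ℝ) (hm : m ≠ 0) (t : ℝ)
    (ht : (m.map fun r => X - C r).prod.eval t ≠ 0) :
    0 < (derivative (m.map fun r => X - C r).prod).eval t ^ 2 -
      (m.map fun r => X - C r).prod.eval t *
        (derivative (derivative (m.map fun r => X - C r).prod)).eval t := by
  induction m using Multiset.induction_on with
  | empty => exact absurd rfl hm
  | cons r m ih =>
    simp only [Multiset.map_cons, Multiset.prod_cons, eval_mul, eval_sub, eval_X, eval_C] at ht ⊢
    set f := (m.map fun r => X - C r).prod with hf
    have hft : f.eval t ≠ 0 := right_ne_zero_of_mul ht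
    have hrt : t - r ≠ 0 := left_ne_zero_of_mul ht
    have hL : 0 ≤ (derivative f).eval t ^ 2 - f.eval t * (derivative (derivative f)).eval t := by
      rcases eq_or_ne m 0 with rfl | h
      · simp [hf]
      · exact (ih h hft).le
    simp only [derivative_mul, derivative_sub, derivative_X, derivative_C, sub_zero, one_mul,
      derivative_add, eval_add, eval_mul, eval_sub, eval_X, eval_C]
    have h1 : 0 < f.eval t ^ 2 := by positivity
    have h2 := mul_nonneg (sq_nonneg (t - r)) hL
    linarith

/-- A multiple root of the derivative of a real-rooted polynomial is a root of the polynomial,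
of multiplicity one more. -/
theorem Splits.pow_succ_dvd_of_pow_dvd_derivative {p : ℝ[X]} (hp : p.Splits)
    (hp' : derivative p ≠ 0) {c : ℝ} {e : ℕ} (he : 2 ≤ e) (h : (X - C c) ^ e ∣ derivative p) :
    (X - C c) ^ (e + 1) ∣ p := by
  have hp0 : p ≠ 0 := by
    rintro rfl
    simp at hp'
  have hroot : p.IsRoot c := by
    by_contra hc
    have h1 : (derivative p).eval c = 0 :=
      dvd_iff_isRoot.mp ((dvd_pow_self _ (by omega)).trans h)
    have h2 : (derivative (derivative p)).eval c = 0 := by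
      obtain ⟨g, hg⟩ := (pow_dvd_pow _ he).trans h
      rw [hg]
      simp [derivative_mul, derivative_pow]
    obtain ⟨m, hm⟩ := splits_iff_exists_multiset.mp hp
    have hm0 : m ≠ 0 := by
      rintro rfl
      rw [hm] at hp'
      simp at hp'
    have hl := leadingCoeff_ne_zero.mpr hp0
    have hL := laguerre_multiset_prod_pos m hm0 c
    rw [hm] at h1 h2
    simp only [derivative_C_mul, eval_mul, eval_C, mul_eq_zero, hl, false_or] at h1 h2
    rw [h1, h2] at hL
    have := hL fun h0 => hc (by rw [IsRoot, hm, eval_mul, h0, mul_zero])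
    simp at this
  rw [← le_rootMultiplicity_iff hp0]
  rw [← le_rootMultiplicity_iff hp', derivative_rootMultiplicity_of_root hroot] at h
  omega

theorem pow_inv_dvd_reflect {p : ℝ[X]} {N : ℕ} (hN : p.natDegree ≤ N) {c : ℝ} (hc : c ≠ 0) {e : ℕ}
    (h : (X - C c) ^ e ∣ p) : (X - C c⁻¹) ^ e ∣ p.reflect N := by
  induction e generalizing p N with
  | zero => simp
  | succ e ih =>
    obtain ⟨q, rfl⟩ := h
    rcases eq_or_ne q 0 with rfl | hq
    · simp
    have hne : (X - C c) ^ e * q ≠ 0 := mul_ne_zero (pow_ne_zero _ (X_sub_C_ne_zero c)) hq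
    rw [pow_succ' (X - C c), mul_assoc] at hN ⊢
    rw [natDegree_mul (X_sub_C_ne_zero c) hne, natDegree_X_sub_C] at hN
    obtain ⟨N, rfl⟩ : ∃ M, N = 1 + M := ⟨N - 1, by omega⟩
    rw [reflect_mul _ _ (natDegree_X_sub_C c).le (by omega), pow_succ']
    refine mul_dvd_mul ?_ (ih (by omega) (dvd_mul_right _ _))
    refine ⟨C (-c), ?_⟩
    rw [sub_eq_add_neg, reflect_add, reflect_one_X, ← C_neg, reflect_C, sub_mul, ← C_mul]
    simp [hc]
    ring

theorem polar_eq_reflect {p : ℝ[X]} {d : ℕ} (hd : p.natDegree ≤ d + 1) :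
    C (d + 1 : ℝ) * p - X * derivative p = (derivative (p.reflect (d + 1))).reflect d := by
  ext i
  have hX : (X * derivative p).coeff i = i * p.coeff i := by
    cases i with
    | zero => simp
    | succ i => rw [coeff_X_mul, coeff_derivative]; push_cast; ring
  rw [coeff_sub, coeff_C_mul, hX, coeff_reflect, coeff_derivative, coeff_reflect]
  rcases le_or_gt i d with h | h
  · rw [revAt_le h, revAt_le (by omega), show d + 1 - (d - i + 1) = i by omega, Nat.cast_sub h]
    ring
  · rw [revAt_eq_self_of_lt h, revAt_eq_self_of_lt (by omega),
      coeff_eq_zero_of_natDegree_lt (by omega : p.natDegree < i + 1)]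
    rcases eq_or_lt_of_le (Nat.succ_le_of_lt h) with h' | h'
    · rw [← h']; push_cast; ring
    · rw [coeff_eq_zero_of_natDegree_lt (by omega)]; ring

theorem Splits.polar_zero {p : ℝ[X]} (hp : p.Splits) {d : ℕ} (hd : p.natDegree ≤ d + 1) :
    (C (d + 1 : ℝ) * p - X * derivative p).Splits := by
  rw [polar_eq_reflect hd]
  refine (hp.reflect hd).derivative_real.reflect ?_
  have h1 : (p.reflect (d + 1)).natDegree ≤ d + 1 := natDegree_reflect_le.trans (by simp [hd])
  exact (natDegree_derivative_le _).trans (by omega)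

theorem Splits.pow_succ_dvd_of_pow_dvd_polar_zero {p : ℝ[X]} (hp : p.Splits) {d : ℕ}
    (hd : p.natDegree ≤ d + 1) (hne : C (d + 1 : ℝ) * p - X * derivative p ≠ 0) {c : ℝ}
    (hc : c ≠ 0) {e : ℕ} (he : 2 ≤ e) (h : (X - C c) ^ e ∣ C (d + 1 : ℝ) * p - X * derivative p) :
    (X - C c) ^ (e + 1) ∣ p := by
  have h1 : (p.reflect (d + 1)).natDegree ≤ d + 1 := natDegree_reflect_le.trans (by simp [hd])
  have h2 : (derivative (p.reflect (d + 1))).natDegree ≤ d :=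
    (natDegree_derivative_le _).trans (by omega)
  rw [polar_eq_reflect hd] at h hne
  have h3 := pow_inv_dvd_reflect (natDegree_reflect_le.trans (max_le le_rfl h2)) hc h
  rw [reflect_reflect] at h3
  have h4 := (hp.reflect hd).pow_succ_dvd_of_pow_dvd_derivative
    (fun h0 => hne (by rw [h0, reflect_zero])) he h3
  have h5 := pow_inv_dvd_reflect h1 (inv_ne_zero hc) h4
  rwa [reflect_reflect, inv_inv] at h5

theorem pow_dvd_of_pow_dvd_polar_zero {p : ℝ[X]} {d : ℕ}
    (hd : p.natDegree ≤ d + 1) (hne : C (d + 1 : ℝ) * p - X * derivative p ≠ 0) {e : ℕ}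
    (h : X ^ e ∣ C (d + 1 : ℝ) * p - X * derivative p) : X ^ e ∣ p := by
  have hcoeff (i : ℕ) : (C (d + 1 : ℝ) * p - X * derivative p).coeff i
      = (d + 1 - i) * p.coeff i := by
    have hX : (X * derivative p).coeff i = i * p.coeff i := by
      cases i with
      | zero => simp
      | succ i => rw [coeff_X_mul, coeff_derivative]; push_cast; ring
    rw [coeff_sub, coeff_C_mul, hX]
    ring
  rw [X_pow_dvd_iff] at h ⊢
  have hed : e ≤ d := by
    by_contra! hlt
    refine hne (ext fun i => ?_)
    rcases lt_or_ge i e with hi | hi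
    · rw [h i hi, coeff_zero]
    rw [hcoeff, coeff_zero]
    rcases eq_or_lt_of_le (show d + 1 ≤ i by omega) with rfl | hi'
    · push_cast; ring
    · rw [coeff_eq_zero_of_natDegree_lt (by omega), mul_zero]
  intro i hi
  have h0 := h i hi
  rw [hcoeff, mul_eq_zero] at h0
  refine h0.resolve_left ?_
  have : (i : ℝ) < d + 1 := by exact_mod_cast (by omega : i < d + 1)
  linarith

theorem polar_comp (p : ℝ[X]) (d : ℕ) (b : ℝ) :
    (C (d + 1 : ℝ) * p - (X - C b) * derivative p).comp (X + C b) =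
      C (d + 1 : ℝ) * p.comp (X + C b) - X * derivative (p.comp (X + C b)) := by
  simp [derivative_comp]

theorem pow_X_sub_C_dvd_comp {p : ℝ[X]} {c : ℝ} {e : ℕ} (h : (X - C c) ^ e ∣ p) (b : ℝ) :
    (X - C (c - b)) ^ e ∣ p.comp (X + C b) := by
  obtain ⟨q, rfl⟩ := h
  refine ⟨q.comp (X + C b), ?_⟩
  simp only [mul_comp, pow_comp, sub_comp, X_comp, C_comp, C_sub]
  ring

theorem comp_X_add_C_comp_neg (p : ℝ[X]) (b : ℝ) : (p.comp (X + C b)).comp (X + C (-b)) = p := by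
  simp [comp_assoc]

/-- The polar derivative of a real-rooted form of degree `d + 1` at a real point is real-rooted. -/
theorem Splits.polar {p : ℝ[X]} (hp : p.Splits) {d : ℕ} (hd : p.natDegree ≤ d + 1) (b : ℝ) :
    (C (d + 1 : ℝ) * p - (X - C b) * derivative p).Splits := by
  rw [← comp_X_add_C_comp_neg (C (d + 1 : ℝ) * p - (X - C b) * derivative p) b, polar_comp]
  exact ((hp.comp_X_add_C b).polar_zero (by simpa [natDegree_comp] using hd)).comp_X_add_C _

/-- A multiple root of the polar derivative of a real-rooted form at `b` is a root of the form,
with multiplicity one more unless it is `b` itself. -/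
theorem Splits.pow_dvd_of_pow_dvd_polar {p : ℝ[X]} (hp : p.Splits) {d : ℕ}
    (hd : p.natDegree ≤ d + 1) {b : ℝ}
    (hne : C (d + 1 : ℝ) * p - (X - C b) * derivative p ≠ 0) {c : ℝ} {e : ℕ} (he : 2 ≤ e)
    (h : (X - C c) ^ e ∣ C (d + 1 : ℝ) * p - (X - C b) * derivative p) :
    (X - C c) ^ (if c = b then e else e + 1) ∣ p := by
  have h1 := pow_X_sub_C_dvd_comp h b
  have hd' : (p.comp (X + C b)).natDegree ≤ d + 1 := by simpa [natDegree_comp] using hd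
  have hne' : C (d + 1 : ℝ) * p.comp (X + C b) - X * derivative (p.comp (X + C b)) ≠ 0 := by
    rw [← polar_comp]
    intro h0
    apply hne
    rw [← comp_X_add_C_comp_neg (C (d + 1 : ℝ) * p - (X - C b) * derivative p) b, h0, zero_comp]
  rw [polar_comp] at h1
  have key : (X - C (c - b)) ^ (if c = b then e else e + 1) ∣ p.comp (X + C b) := by
    split_ifs with hcb
    · simp only [hcb, sub_self, C_0, sub_zero] at h1 ⊢
      exact pow_dvd_of_pow_dvd_polar_zero hd' hne' h1
    · exact (hp.comp_X_add_C b).pow_succ_dvd_of_pow_dvd_polar_zero hd' hne'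
        (sub_ne_zero.mpr hcb) he h1
  have h2 := pow_X_sub_C_dvd_comp key (-b)
  rwa [comp_X_add_C_comp_neg, sub_neg_eq_add, sub_add_cancel] at h2

end Polynomial

open Polynomial

/-- The polynomial `∑ i ≤ d, C(d, i) a_{d - i} X ^ i`, whose normalized coefficients, from the top
one down, are `a_0, …, a_d`. -/
noncomputable def binomPoly (d : ℕ) (a : ℕ → ℝ) : ℝ[X] :=
  ∑ i ∈ Finset.range (d + 1), monomial i (d.choose i * a (d - i))

theorem coeff_binomPoly (d : ℕ) (a : ℕ → ℝ) (i : ℕ) :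
    (binomPoly d a).coeff i = d.choose i * a (d - i) := by
  simp only [binomPoly, finsetSum_coeff, coeff_monomial, Finset.sum_ite_eq', Finset.mem_range]
  split_ifs with h
  · rfl
  · rw [Nat.choose_eq_zero_of_lt (by omega)]; simp

theorem natDegree_binomPoly_le (d : ℕ) (a : ℕ → ℝ) : (binomPoly d a).natDegree ≤ d := by
  rw [natDegree_le_iff_coeff_eq_zero]
  intro i hi
  rw [coeff_binomPoly, Nat.choose_eq_zero_of_lt hi]
  simp

theorem derivative_binomPoly (d : ℕ) (a : ℕ → ℝ) :
    derivative (binomPoly (d + 1) a) = C (d + 1 : ℝ) * binomPoly d a := by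
  ext i
  rw [coeff_derivative, coeff_C_mul, coeff_binomPoly, coeff_binomPoly, Nat.add_sub_add_right]
  have h : ((d + 1 : ℕ) : ℝ) * d.choose i = (d + 1).choose (i + 1) * (i + 1 : ℕ) := by
    exact_mod_cast Nat.add_one_mul_choose_eq d i
  push_cast at h
  linear_combination -a (d - i) * h

/-- The shift `a ↦ (j ↦ a (j + 1))` on real sequences. -/
noncomputable def seqShift : Module.End ℝ (ℕ → ℝ) := LinearMap.funLeft ℝ ℝ Nat.succ

theorem seqShift_pow_apply (m : ℕ) (a : ℕ → ℝ) (j : ℕ) : (seqShift ^ m) a j = a (j + m) := by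
  induction m generalizing a j with
  | zero => simp
  | succ m ih =>
    rw [pow_succ, Module.End.mul_apply, ih]
    rfl

theorem aeval_seqShift_X_add_C_apply (b : ℝ) (a : ℕ → ℝ) (j : ℕ) :
    aeval seqShift (X + C b) a j = a (j + 1) + b * a j := by
  simp [seqShift, Module.algebraMap_end_apply, LinearMap.funLeft_apply]

theorem polar_binomPoly (d : ℕ) (a : ℕ → ℝ) (b : ℝ) :
    C (d + 1 : ℝ) * binomPoly (d + 1) a - (X - C b) * derivative (binomPoly (d + 1) a) =
      C (d + 1 : ℝ) * binomPoly d (aeval seqShift (X + C b) a) := by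
  rw [derivative_binomPoly]
  ext i
  rw [sub_mul, coeff_sub, coeff_sub]
  cases i with
  | zero =>
    simp only [mul_coeff_zero, coeff_X_zero, zero_mul, coeff_binomPoly,
      aeval_seqShift_X_add_C_apply, Nat.choose_zero_right, Nat.cast_one, Nat.sub_zero, coeff_C_zero]
    ring
  | succ i =>
    rw [coeff_X_mul]
    simp only [coeff_C_mul, coeff_binomPoly, aeval_seqShift_X_add_C_apply]
    rcases le_or_gt (i + 1) d with h | h
    · rw [show d + 1 - (i + 1) = d - i by omega, show d - (i + 1) + 1 = d - i by omega,
        Nat.choose_succ_succ]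
      push_cast
      ring
    · rw [Nat.choose_eq_zero_of_lt h, Nat.choose_succ_succ, Nat.choose_eq_zero_of_lt h]
      simp

/-- Multiplicities lift through iterated polar derivatives at the points of a multiset `B`. -/
theorem exists_pow_dvd_binomPoly (B : Multiset ℝ) {M : ℕ} (hM : 2 ≤ M) (a : ℕ → ℝ) (c : ℝ)
    (hs : (binomPoly (M + B.card) a).Splits)
    (hne : binomPoly M (aeval seqShift (B.map fun b => X + C b).prod a) ≠ 0)
    (h : (X - C c) ^ M ∣ binomPoly M (aeval seqShift (B.map fun b => X + C b).prod a)) :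
    binomPoly (M + B.card) a ≠ 0 ∧ ∃ e, M ≤ e ∧ M + B.card ≤ e + B.count c ∧
      (X - C c) ^ e ∣ binomPoly (M + B.card) a := by
  induction B using Multiset.induction_on generalizing a with
  | empty => exact ⟨by simpa using hne, M, le_rfl, by simp, by simpa using h⟩
  | cons b B ih =>
    rw [Multiset.card_cons, ← add_assoc] at hs ⊢
    rw [Multiset.map_cons, Multiset.prod_cons, mul_comm, map_mul, Module.End.mul_apply] at hne h
    set d := M + B.card with hd
    have hpolar := polar_binomPoly d a b
    have hd0 : (C (d + 1 : ℝ) : ℝ[X]) ≠ 0 := C_ne_zero.mpr (by positivity)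
    have hunit : IsUnit (C (d + 1 : ℝ) : ℝ[X]) := isUnit_C.mpr (Ne.isUnit (by positivity))
    have hdeg := natDegree_binomPoly_le (d + 1) a
    have hsp := hs.polar hdeg b
    rw [hpolar, splits_mul_iff_right hd0 (Splits.C _)] at hsp
    obtain ⟨hne', e, hMe, hcard, hdvd⟩ := ih _ hsp hne h
    have hne2 := mul_ne_zero hd0 hne'
    have hdvd2 := hdvd.mul_left (C (d + 1 : ℝ))
    rw [← hpolar] at hne2 hdvd2
    refine ⟨fun h0 => hne2 (by rw [h0]; simp), _, ?_, ?_,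
      hs.pow_dvd_of_pow_dvd_polar hdeg hne2 (hM.trans hMe) hdvd2⟩
    · split_ifs <;> omega
    · rw [Multiset.count_cons]
      split_ifs <;> omega

theorem splits_binomPoly_of_splits_add (d m : ℕ) (a : ℕ → ℝ) (hs : (binomPoly (d + m) a).Splits) :
    (binomPoly d a).Splits := by
  induction m with
  | zero => exact hs
  | succ m ih =>
    have h := hs.derivative_real
    rw [← add_assoc, derivative_binomPoly,
      splits_mul_iff_right (C_ne_zero.mpr (by positivity)) (Splits.C _)] at h
    exact ih h

theorem pow_dvd_binomPoly_add (d m : ℕ) (a : ℕ → ℝ) (hs : (binomPoly (d + m) a).Splits)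
    (hne : binomPoly d a ≠ 0) {c : ℝ} {e : ℕ} (he : 2 ≤ e) (h : (X - C c) ^ e ∣ binomPoly d a) :
    (X - C c) ^ (e + m) ∣ binomPoly (d + m) a := by
  induction m generalizing d e with
  | zero => exact h
  | succ m ih =>
    rw [← add_assoc, add_right_comm] at hs
    have hd := derivative_binomPoly d a
    have hs1 := splits_binomPoly_of_splits_add _ _ _ hs
    have hne1 : derivative (binomPoly (d + 1) a) ≠ 0 :=
      hd ▸ mul_ne_zero (C_ne_zero.mpr (by positivity)) hne
    have h1 := hs1.pow_succ_dvd_of_pow_dvd_derivative hne1 he (hd ▸ h.mul_left _)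
    rw [← add_assoc d, add_right_comm d, add_comm m, ← add_assoc]
    exact ih (d + 1) hs (fun h0 => hne1 (by rw [h0, derivative_zero])) (by omega) h1

theorem esymmFin_eq_esymm {m : ℕ} (v : Fin m → ℝ) (k : ℕ) :
    esymmFin v k = (Finset.univ.val.map v).esymm k :=
  (Finset.esymm_map_val v Finset.univ k).symm

theorem prod_X_add_C_eq_binomPoly {n : ℕ} (x : Fin n → ℝ) :
    ((Finset.univ.val.map x).map fun r => X + C r).prod =
      binomPoly n fun j => esymmFin x j / n.choose j := by
  have hcard : (Finset.univ.val.map x).card = n := by simp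
  ext i
  rw [coeff_binomPoly]
  rcases le_or_gt i n with h | h
  · rw [Multiset.prod_X_add_C_coeff _ (by rwa [hcard]), hcard, esymmFin_eq_esymm,
      Nat.choose_symm h]
    have : (n.choose i : ℝ) ≠ 0 := by exact_mod_cast (Nat.choose_pos h).ne'
    field_simp
  · rw [Nat.choose_eq_zero_of_lt h, coeff_eq_zero_of_natDegree_lt]
    · simp
    · refine (natDegree_multiset_prod_le _).trans_lt ?_
      simpa [Function.comp_def] using h

theorem Ssk_eq_aeval_seqShift {n s m : ℕ} (x : Fin n → ℝ) (β : Fin s → ℝ) (α : Fin s → ℝ)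
    (hα : ∀ i : Fin s, α i = esymmFin β ((i : ℕ) + 1)) (j : ℕ) :
    Ssk x α ((s + m + j : ℕ) : ℤ) =
      aeval seqShift ((Finset.univ.val.map β + Multiset.replicate m 0).map fun b => X + C b).prod
        (fun i => esymmFin x i / n.choose i) j := by
  have hE (i : ℕ) : emeanZ x (i : ℤ) = esymmFin x i / n.choose i := by simp [emeanZ]
  have hcard : (Finset.univ.val.map β).card = s := by simp
  rw [Multiset.map_add, Multiset.prod_add, Multiset.prod_X_add_C_eq_sum_esymm, hcard,
    Finset.sum_range_succ']
  simp only [Multiset.map_replicate, C_0, add_zero, Multiset.prod_replicate, add_mul,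
    Finset.sum_mul, map_add, map_sum, map_mul, map_pow, aeval_X, aeval_C, LinearMap.add_apply,
    LinearMap.sum_apply, Pi.add_apply, Finset.sum_apply, Module.End.mul_apply,
    Module.algebraMap_end_apply, Pi.smul_apply, smul_eq_mul, seqShift_pow_apply]
  rw [Finset.sum_range, Ssk, hE, add_comm (_ / _)]
  congr 1
  · refine Finset.sum_congr rfl fun i _ => ?_
    have hi := i.isLt
    rw [hα, esymmFin_eq_esymm β, ← hE]
    congr 2
    omega
  · simp [Multiset.esymm, add_comm, add_left_comm]

theorem binomPoly_two_eq_of_sq_eq {a : ℕ → ℝ} (h0 : a 0 ≠ 0) (h : a 1 ^ 2 = a 0 * a 2) :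
    binomPoly 2 a = C (a 0) * (X - C (-a 1 / a 0)) ^ 2 := by
  obtain ⟨w, hw⟩ : ∃ w, w = a 1 / a 0 := ⟨_, rfl⟩
  have h1 : a 1 = a 0 * w := by rw [hw]; field_simp
  have h2 : a 2 = a 0 * w ^ 2 := mul_left_cancel₀ h0 (by rw [← h, h1]; ring)
  rw [neg_div, ← hw, binomPoly]
  simp only [Finset.sum_range_succ, Finset.sum_range_zero, ← C_mul_X_pow_eq_monomial,
    Nat.choose_zero_right, Nat.choose_one_right, Nat.choose_self, Nat.sub_zero, Nat.sub_self,
    Nat.add_one_sub_one, h1, h2, C_mul, C_pow, C_neg, Nat.cast_one, Nat.cast_ofNat, C_1, C_ofNat]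
  ring

/-- Equality case of the Newton-type inequality for `S_{k;s}`: if equality holds and the two
sides are not both zero, then some real value occurs at least `n` times among
`x_1,…,x_n, -β_1,…,-β_s`. -/
theorem newton_equality_case_Ssk (n s : ℕ) (hn : 2 < n) (hs1 : 1 ≤ s) (hs2 : s < n - 1)
    (x : Fin n → ℝ) (β : Fin s → ℝ) (α : Fin s → ℝ)
    (hα : ∀ i : Fin s, α i = esymmFin β ((i : ℕ) + 1))
    (k : ℤ) (hk1 : (s : ℤ) + 1 ≤ k) (hk2 : k ≤ (n : ℤ) - 1)
    (heq : Ssk x α k ^ 2 = Ssk x α (k - 1) * Ssk x α (k + 1))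
    (hne : ¬(Ssk x α k ^ 2 = 0 ∧ Ssk x α (k - 1) * Ssk x α (k + 1) = 0)) :
    ∃ c : ℝ, n ≤ (Finset.univ.filter (fun i : Fin n => x i = c)).card
        + (Finset.univ.filter (fun j : Fin s => -β j = c)).card := by
  obtain ⟨m, rfl⟩ : ∃ m : ℕ, k = ((s + m + 1 : ℕ) : ℤ) := ⟨(k - s - 1).toNat, by omega⟩
  obtain ⟨r, rfl⟩ : ∃ r : ℕ, n = 2 + (s + m) + r := ⟨n - (2 + (s + m)), by omega⟩
  set B := Finset.univ.val.map β + Multiset.replicate m 0 with hB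
  set a : ℕ → ℝ := fun i => esymmFin x i / (2 + (s + m) + r).choose i with ha
  set S := aeval seqShift (B.map fun b => X + C b).prod a with hS
  have hSj (j : ℕ) : Ssk x α ((s + m + j : ℕ) : ℤ) = S j := Ssk_eq_aeval_seqShift x β α hα j
  have e0 : ((s + m + 1 : ℕ) : ℤ) - 1 = ((s + m + 0 : ℕ) : ℤ) := by push_cast; ring
  have e2 : ((s + m + 1 : ℕ) : ℤ) + 1 = ((s + m + 2 : ℕ) : ℤ) := by push_cast; ring
  rw [e0, e2, hSj, hSj, hSj] at heq hne
  have hS1 : S 1 ≠ 0 := fun h => hne ⟨by rw [h]; simp, by rw [← heq, h]; simp⟩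
  have hS0 : S 0 ≠ 0 := fun h => hS1 (by simpa [h] using heq)
  have hquad := binomPoly_two_eq_of_sq_eq hS0 heq
  set c := -S 1 / S 0 with hc
  have hc0 : c ≠ 0 := div_ne_zero (neg_ne_zero.mpr hS1) hS0
  have hcardB : B.card = s + m := by simp [hB]
  have hprod := prod_X_add_C_eq_binomPoly x
  have hsplit : (binomPoly (2 + (s + m) + r) a).Splits := by
    rw [← hprod]
    refine Splits.multisetProd fun f hf => ?_
    obtain ⟨b, -, rfl⟩ := Multiset.mem_map.mp hf
    exact Splits.X_add_C b
  have hsplit' := splits_binomPoly_of_splits_add _ _ _ hsplit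
  rw [← hcardB] at hsplit'
  obtain ⟨hne', e, he, hcount, hdvd⟩ := exists_pow_dvd_binomPoly B le_rfl a c hsplit'
    (by rw [← hS, hquad]
        exact mul_ne_zero (C_ne_zero.mpr hS0) (pow_ne_zero _ (X_sub_C_ne_zero c)))
    (by rw [← hS, hquad]; exact dvd_mul_left _ _)
  rw [hcardB] at hne' hcount hdvd
  have hdvd' := pow_dvd_binomPoly_add _ r a hsplit hne' he hdvd
  have hneg : ((Finset.univ.val.map x).map fun r => X + C r) =
      ((Finset.univ.val.map fun i => -x i).map fun r => X - C r) := by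
    simp [Function.comp_def]
  have hmonic : ((Finset.univ.val.map fun i => -x i).map fun r => X - C r).prod ≠ 0 :=
    (monic_multiset_prod_of_monic _ _ fun r _ => monic_X_sub_C r).ne_zero
  rw [ha, ← hprod, hneg, ← le_rootMultiplicity_iff hmonic, ← count_roots,
    roots_multiset_prod_X_sub_C, Multiset.count_map] at hdvd'
  rw [hB, Multiset.count_add, Multiset.count_replicate, if_neg hc0.symm, Multiset.count_map]
    at hcount
  refine ⟨-c, ?_⟩
  have h1 : (Finset.univ.filter fun i => x i = -c).card =
      (Finset.univ.val.filter fun i => c = -x i).card := by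
    rw [Finset.card_def, Finset.filter_val]
    congr 2
    ext i
    constructor <;> intro h <;> linarith
  have h2 : (Finset.univ.filter fun j => -β j = -c).card =
      (Finset.univ.val.filter fun j => c = β j).card := by
    rw [Finset.card_def, Finset.filter_val]
    congr 2
    ext i
    constructor <;> intro h <;> linarith
  omega
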